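/- Let Y1, Y2 be independent positive random variables with P(Y_i > u) ∼ C_i u^{α_i} exp(-L_i u^{p_i}) as u → ∞ (C_i, L_i, p_i > 0, α_i ∈ ℝ). Then P(Y1Y2 > u) ∼ (2π p2 L2/(p1+p2))^{1/2} C1 C2 A^{p2/2 + α2 - α1} u^{(2p2α1 + 2p1α2 + p1p2)/(2(p1+p2))} exp(-B u^{p1p2/(p1+p2)}) as u → ∞, where A = ((p1L1)/(p2L2))^{1/(p1+p2)} and B = L1 A^{-p1} + L2 A^{p2}. -/

import Mathlib

open MeasureTheory ProbabilityTheory Filter Topology Real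

/-- The normalized exponent. -/
noncomputable def wE (D p q t : ℝ) : ℝ :=
  D * ((exp (-(p * t)) - 1 + p * t) / p + (exp (q * t) - 1 - q * t) / q)

lemma wE_lower {D p q : ℝ} (hD : 0 < D) (hp : 0 < p) (hq : 0 < q) (t : ℝ) :
    D * min p q / 2 * t ^ 2 ≤ wE D p q t := by
  unfold wE
  have h1 : 0 ≤ (exp (-(p * t)) - 1 + p * t) / p := by
    have := add_one_le_exp (-(p * t))
    apply div_nonneg _ hp.le; linarith
  have h2 : 0 ≤ (exp (q * t) - 1 - q * t) / q := by
    have := add_one_le_exp (q * t)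
    apply div_nonneg _ hq.le; linarith
  have key : min p q / 2 * t ^ 2 ≤
      (exp (-(p * t)) - 1 + p * t) / p + (exp (q * t) - 1 - q * t) / q := by
    rcases le_total 0 t with ht | ht
    · have h3 := quadratic_le_exp_of_nonneg (mul_nonneg hq.le ht)
      have h4 : q / 2 * t ^ 2 ≤ (exp (q * t) - 1 - q * t) / q := by
        rw [le_div_iff₀ hq]; nlinarith
      have : min p q / 2 * t ^ 2 ≤ q / 2 * t ^ 2 := by
        gcongr; exact min_le_right _ _
      linarith
    · have h3 := quadratic_le_exp_of_nonneg (x := -(p * t)) (by nlinarith)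
      have h4 : p / 2 * t ^ 2 ≤ (exp (-(p * t)) - 1 + p * t) / p := by
        rw [le_div_iff₀ hp]; nlinarith
      have : min p q / 2 * t ^ 2 ≤ p / 2 * t ^ 2 := by
        gcongr; exact min_le_left _ _
      linarith
  calc _ = D * (min p q / 2 * t ^ 2) := by ring
    _ ≤ _ := by gcongr

lemma exp_second (k : ℝ) :
    Tendsto (fun t : ℝ => (exp (k * t) - 1 - k * t) / t ^ 2) (𝓝[≠] 0) (𝓝 (k ^ 2 / 2)) := by
  rw [tendsto_iff_norm_sub_tendsto_zero]
  have hb : Tendsto (fun t : ℝ => |k| ^ 3 * |t|) (𝓝[≠] 0) (𝓝 0) := by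
    have : Tendsto (fun t : ℝ => |k| ^ 3 * |t|) (𝓝 0) (𝓝 (|k| ^ 3 * |0|)) :=
      Continuous.tendsto (by fun_prop) 0
    simp only [abs_zero, mul_zero] at this
    exact this.mono_left nhdsWithin_le_nhds
  refine squeeze_zero' (Eventually.of_forall fun _ => norm_nonneg _) ?_ hb
  have hs : ∀ᶠ t : ℝ in 𝓝[≠] 0, |k * t| < 1 := by
    have : Tendsto (fun t : ℝ => |k * t|) (𝓝 0) (𝓝 (|k * 0|)) :=
      Continuous.tendsto (by fun_prop) 0
    simp only [mul_zero, abs_zero] at this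
    exact (this.mono_left nhdsWithin_le_nhds).eventually_lt_const one_pos
  filter_upwards [hs, self_mem_nhdsWithin] with t ht ht0
  have ht0 : t ≠ 0 := ht0
  have h := Real.exp_bound (x := k * t) ht.le (n := 3) (by norm_num)
  simp [Finset.sum_range_succ, Nat.factorial] at h
  have e : (exp (k * t) - 1 - k * t) / t ^ 2 - k ^ 2 / 2 =
      (exp (k * t) - (1 + k * t + (k * t) ^ 2 / 2)) / t ^ 2 := by
    field_simp; ring
  rw [e, norm_eq_abs, abs_div, abs_of_pos (by positivity : 0 < t ^ 2), div_le_iff₀ (by positivity)]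
  refine h.trans ?_
  rw [mul_pow]
  have : |t| ^ 3 = |t| * t ^ 2 := by rw [pow_succ, sq_abs]; ring
  rw [this]
  have : 0 ≤ |k| ^ 3 * (|t| * t ^ 2) := by positivity
  nlinarith

lemma wE_lim {D p q : ℝ} (hp : 0 < p) (hq : 0 < q) (s : ℝ) :
    Tendsto (fun l : ℝ => l * wE D p q (s / √l)) atTop (𝓝 (D * (p + q) / 2 * s ^ 2)) := by
  rcases eq_or_ne s 0 with rfl | hs
  · simp [wE]
  have ht : Tendsto (fun l : ℝ => s / √l) atTop (𝓝[≠] 0) := by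
    rw [tendsto_nhdsWithin_iff]
    refine ⟨tendsto_const_nhds.div_atTop tendsto_sqrt_atTop, ?_⟩
    filter_upwards [eventually_gt_atTop 0] with l hl
    have := sqrt_pos.2 hl
    simp [hs, this.ne']
  have h1 := (exp_second (-p)).comp ht
  have h2 := (exp_second q).comp ht
  have h := ((h1.div_const p).add (h2.div_const q)).const_mul (D * s ^ 2)
  have e : D * s ^ 2 * ((-p) ^ 2 / 2 / p + q ^ 2 / 2 / q) = D * (p + q) / 2 * s ^ 2 := by
    field_simp
  rw [e] at h
  refine h.congr' ?_
  filter_upwards [eventually_gt_atTop 0] with l hl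
  have hl' := sqrt_pos.2 hl
  have hsq : (s / √l) ^ 2 = s ^ 2 / l := by rw [div_pow, sq_sqrt hl.le]
  simp only [Function.comp, wE, hsq]
  field_simp
  ring_nf

lemma wbound {G : ℝ → ℝ} (hG1 : ∀ x, G x ≤ 1) (hG0 : ∀ x, 0 ≤ G x)
    {C L p α : ℝ} (hL : 0 < L) (hp : 0 < p)
    (h : Tendsto (fun x => G x / (x ^ α * exp (-(L * x ^ p)))) atTop (𝓝 C)) :
    ∃ M, 0 ≤ M ∧ ∀ x, 0 < x →
      |G x / (x ^ α * exp (-(L * x ^ p)))| ≤ M * (1 + x ^ (-|α|)) := by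
  obtain ⟨K, hK⟩ := (eventually_atTop.1 (h.eventually_lt_const (lt_add_one C)))
  set K' := max K 1
  have hK'1 : 1 ≤ K' := le_max_right _ _
  refine ⟨max (C + 1) 0 + exp (L * K' ^ p) * K' ^ |α|, by positivity, fun x hx => ?_⟩
  have hxa : 0 < x ^ (-|α|) := rpow_pos_of_pos hx _
  rw [abs_of_nonneg (by have := hG0 x; positivity)]
  rcases le_total K' x with hx' | hx'
  · have := (hK x ((le_max_left _ _).trans hx')).le
    have h2 : C + 1 ≤ max (C + 1) 0 + exp (L * K' ^ p) * K' ^ |α| := by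
      have := le_max_left (C + 1) 0
      have : 0 ≤ exp (L * K' ^ p) * K' ^ |α| := by positivity
      linarith
    calc _ ≤ _ := this
      _ ≤ _ := h2
      _ ≤ _ := le_mul_of_one_le_right (by positivity) (by linarith)
  · have e : G x / (x ^ α * exp (-(L * x ^ p))) ≤ exp (L * x ^ p) * x ^ (-α) := by
      rw [exp_neg, rpow_neg hx.le, div_le_iff₀ (by positivity)]
      have : 0 < x ^ α := rpow_pos_of_pos hx _
      calc G x ≤ 1 := hG1 x
        _ = _ := by field_simp
    have e2 : exp (L * x ^ p) ≤ exp (L * K' ^ p) := by gcongr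
    have hKa : 1 ≤ K' ^ |α| := one_le_rpow hK'1 (abs_nonneg _)
    have e3 : x ^ (-α) ≤ K' ^ |α| * (1 + x ^ (-|α|)) := by
      rcases le_total x 1 with h1 | h1
      · have := rpow_le_rpow_of_exponent_ge hx h1 (show -|α| ≤ -α by
          have := le_abs_self α; linarith)
        nlinarith
      · have a1 := rpow_le_rpow_of_exponent_le h1 (show -α ≤ |α| from neg_le_abs α)
        have a2 : x ^ |α| ≤ K' ^ |α| := by gcongr
        nlinarith
    calc _ ≤ _ := e
      _ ≤ exp (L * K' ^ p) * (K' ^ |α| * (1 + x ^ (-|α|))) := by gcongr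
      _ ≤ _ := by
        have : 0 ≤ max (C + 1) 0 := le_max_right _ _
        have := mul_nonneg this (by linarith : 0 ≤ 1 + x ^ (-|α|))
        nlinarith

/-- change of variables -/
lemma wcov (f : ℝ → ℝ) {a k : ℝ} (ha : 0 < a) (hk : 0 < k) :
    ∫ y in Set.Ioi 0, f y = ∫ s, (a * exp (s / k) / k) * f (a * exp (s / k)) := by
  have himg : (fun s : ℝ => a * exp (s / k)) '' Set.univ = Set.Ioi 0 := by
    ext y
    simp only [Set.image_univ, Set.mem_range, Set.mem_Ioi]
    constructor
    · rintro ⟨s, rfl⟩; positivity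
    · intro hy
      refine ⟨k * log (y / a), ?_⟩
      rw [mul_div_cancel_left₀ _ hk.ne', exp_log (by positivity)]
      field_simp
  have := integral_image_eq_integral_abs_deriv_smul (s := Set.univ)
    (f := fun s : ℝ => a * exp (s / k)) (f' := fun s => a * exp (s / k) / k)
    MeasurableSet.univ
    (fun s _ => by
      have h := (((hasDerivAt_id s).div_const k).exp.const_mul a)
      have h2 : HasDerivAt (fun s : ℝ => a * exp (s / k)) (a * exp (s / k) / k) s := by
        refine h.congr_deriv ?_
        simp only [id]; ring
      exact h2.hasDerivWithinAt)
    (fun x _ y _ hxy => by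
      have h1 := mul_left_cancel₀ ha.ne' hxy
      have h2 := exp_injective h1
      field_simp at h2
      exact h2) f
  rw [himg] at this
  rw [this, Measure.restrict_univ]
  congr 1; ext s
  rw [abs_of_pos (by positivity), smul_eq_mul]

lemma wcore {R r : ℝ → ℝ} (hR : Measurable R) (hr : Measurable r)
    {M a Q C l0 A D p q β : ℝ} (hM : 0 ≤ M) (ha : 0 ≤ a) (hA : 0 < A) (hD : 0 < D)
    (hp : 0 < p) (hq : 0 < q)
    (hRb : ∀ x, 0 < x → |R x| ≤ M * (1 + x ^ (-a))) (hRl : Tendsto R atTop (𝓝 C))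
    (hrb : ∀ y, 0 < y → |r y| ≤ Q) (hrl : Tendsto r atTop (𝓝 l0))
    {m n l : ℝ → ℝ} (hm : Tendsto m atTop atTop) (hn : Tendsto n atTop atTop)
    (hl : Tendsto l atTop atTop) :
    Tendsto (fun u => ∫ s, R (n u / A * exp (-(s / √(l u)))) * r (A * m u * exp (s / √(l u))) *
      exp (β * (s / √(l u))) * exp (-(l u * wE D p q (s / √(l u))))) atTop
      (𝓝 (C * l0 * √(2 * π / (D * (p + q))))) := by
  set c := D * min p q / 2 with hc
  have hcpos : 0 < c := by have := lt_min hp hq; positivity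
  have hQ : 0 ≤ Q := (abs_nonneg _).trans (hrb 1 one_pos)
  have hlim : C * l0 * √(2 * π / (D * (p + q))) =
      ∫ s, C * l0 * exp (-(D * (p + q) / 2) * s ^ 2) := by
    rw [integral_const_mul, integral_gaussian]
    congr 2
    field_simp
  rw [hlim]
  set b := a + |β| with hb
  have hb0 : 0 ≤ b := by positivity
  refine tendsto_integral_filter_of_dominated_convergence
    (fun s => (M * (1 + A ^ a) * Q * exp (b ^ 2 / (2 * c))) * exp (-(c / 2) * s ^ 2)) ?_ ?_ ?_ ?_
  · refine Eventually.of_forall fun u => Measurable.aestronglyMeasurable ?_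
    have hE : Measurable (wE D p q) := by
      apply Continuous.measurable; unfold wE; fun_prop
    fun_prop
  · filter_upwards [hl.eventually_ge_atTop 1, hm.eventually_ge_atTop 1, hn.eventually_ge_atTop 1]
      with u hlu hmu hnu
    refine Eventually.of_forall fun s => ?_
    have hsl : 1 ≤ √(l u) := one_le_sqrt.2 hlu
    set t := s / √(l u) with ht
    have hts : |t| ≤ |s| := by
      rw [ht, abs_div, abs_of_pos (by linarith : 0 < √(l u))]
      exact div_le_self (abs_nonneg _) hsl
    have hE : c * s ^ 2 ≤ l u * wE D p q t := by
      have h1 := mul_le_mul_of_nonneg_left (wE_lower hD hp hq t) (by linarith : 0 ≤ l u)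
      have h2 : l u * (D * min p q / 2 * t ^ 2) = c * s ^ 2 := by
        rw [ht, div_pow, sq_sqrt (by linarith)]; field_simp; rw [hc]; ring
      linarith
    have hx : 0 < n u / A * exp (-t) := by positivity
    have hxa : (n u / A * exp (-t)) ^ (-a) ≤ A ^ a * exp (a * |s|) := by
      rw [rpow_neg hx.le, ← inv_rpow hx.le]
      have : (n u / A * exp (-t))⁻¹ = A * exp t * (n u)⁻¹ := by
        rw [exp_neg]; field_simp
      rw [this]
      calc (A * exp t * (n u)⁻¹) ^ a ≤ (A * exp |s|) ^ a := by
            refine rpow_le_rpow (by positivity) ?_ ha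
            calc A * exp t * (n u)⁻¹ ≤ A * exp t * 1 := by
                  gcongr; exact inv_le_one_of_one_le₀ hnu
              _ ≤ A * exp |s| := by
                  rw [mul_one]; gcongr; exact (le_abs_self t).trans hts
        _ = _ := by
            rw [mul_rpow hA.le (exp_pos _).le, ← exp_mul, mul_comm a]
    have h1 : |R (n u / A * exp (-t))| ≤ M * (1 + A ^ a) * exp (a * |s|) := by
      refine (hRb _ hx).trans ?_
      have : 1 ≤ exp (a * |s|) := one_le_exp (by positivity)
      calc _ ≤ M * (exp (a * |s|) + A ^ a * exp (a * |s|)) := by gcongr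
        _ = _ := by ring
    have h2 := hrb (A * m u * exp t) (by positivity)
    have h3 : exp (β * t) ≤ exp (|β| * |s|) := by
      refine exp_le_exp.2 ?_
      calc β * t ≤ |β * t| := le_abs_self _
        _ = |β| * |t| := abs_mul _ _
        _ ≤ _ := by gcongr
    have h4 : exp (-(l u * wE D p q t)) ≤ exp (-(c * s ^ 2)) := by gcongr
    rw [norm_eq_abs, abs_mul, abs_mul, abs_mul, abs_exp, abs_exp]
    calc _ ≤ M * (1 + A ^ a) * exp (a * |s|) * Q * exp (|β| * |s|) * exp (-(c * s ^ 2)) := by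
          gcongr
      _ = M * (1 + A ^ a) * Q * exp (a * |s| + |β| * |s| + -(c * s ^ 2)) := by
          rw [exp_add, exp_add]; ring
      _ ≤ M * (1 + A ^ a) * Q * exp (b ^ 2 / (2 * c) + -(c / 2) * s ^ 2) := by
          refine mul_le_mul_of_nonneg_left (exp_le_exp.2 ?_) (by positivity)
          have e : b ^ 2 / (2 * c) + -(c / 2) * s ^ 2 - (a * |s| + |β| * |s| + -(c * s ^ 2)) =
              (b - c * |s|) ^ 2 / (2 * c) := by
            rw [hb, ← sq_abs s]; field_simp; ring
          have : 0 ≤ (b - c * |s|) ^ 2 / (2 * c) := by positivity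
          linarith
      _ = _ := by rw [exp_add]; ring
  · exact (integrable_exp_neg_mul_sq (by positivity)).const_mul _
  · refine Eventually.of_forall fun s => ?_
    have ht : Tendsto (fun u => s / √(l u)) atTop (𝓝 0) :=
      tendsto_const_nhds.div_atTop (tendsto_sqrt_atTop.comp hl)
    have he : Tendsto (fun u => exp (s / √(l u))) atTop (𝓝 1) := by
      simpa [Function.comp_def] using (continuous_exp.tendsto 0).comp ht
    have he' : Tendsto (fun u => exp (-(s / √(l u)))) atTop (𝓝 1) := by
      have := (continuous_exp.tendsto (-0)).comp ht.neg
      simpa [Function.comp_def] using this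
    have hb' : Tendsto (fun u => exp (β * (s / √(l u)))) atTop (𝓝 1) := by
      have := (continuous_exp.tendsto (β * 0)).comp (ht.const_mul β)
      simpa [Function.comp_def] using this
    have h1 : Tendsto (fun u => n u / A * exp (-(s / √(l u)))) atTop atTop :=
      (hn.atTop_div_const hA).atTop_mul_pos one_pos he'
    have h2 : Tendsto (fun u => A * m u * exp (s / √(l u))) atTop atTop :=
      (hm.const_mul_atTop hA).atTop_mul_pos one_pos he
    have h3 := (continuous_exp.tendsto _).comp ((wE_lim (D := D) hp hq s).comp hl).neg
    have := (((hRl.comp h1).mul (hrl.comp h2)).mul hb').mul h3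
    simp only [mul_one] at this
    rw [neg_mul]
    exact this

/-- The Laplace normalisation. -/
noncomputable def wT (A B α₁ α₂ p₁ p₂ u : ℝ) : ℝ :=
  (u ^ (p₂ / (p₁ + p₂)) / A) ^ α₁ * (A * u ^ (p₁ / (p₁ + p₂))) ^ (α₂ + p₂) *
    exp (-(B * u ^ (p₁ * p₂ / (p₁ + p₂)))) / √(u ^ (p₁ * p₂ / (p₁ + p₂)))

lemma wlaplace {G r : ℝ → ℝ} (hGm : Measurable G) (hG1 : ∀ x, G x ≤ 1) (hG0 : ∀ x, 0 ≤ G x)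
    (hr : Measurable r) {C₁ L₁ L₂ p₁ p₂ α₁ α₂ A B D Q l0 : ℝ}
    (hL₁ : 0 < L₁) (hp₁ : 0 < p₁) (hp₂ : 0 < p₂) (hA : 0 < A) (hD : 0 < D)
    (hD1 : D = p₁ * L₁ * A ^ (-p₁)) (hD2 : D = p₂ * L₂ * A ^ p₂)
    (hB : B = L₁ * A ^ (-p₁) + L₂ * A ^ p₂)
    (h : Tendsto (fun x => G x / (x ^ α₁ * exp (-(L₁ * x ^ p₁)))) atTop (𝓝 C₁))
    (hrb : ∀ y, 0 < y → |r y| ≤ Q) (hrl : Tendsto r atTop (𝓝 l0)) :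
    Tendsto (fun u => (∫ y in Set.Ioi 0,
        G (u / y) * (r y * (y ^ (α₂ + p₂ - 1) * exp (-(L₂ * y ^ p₂))))) /
        wT A B α₁ α₂ p₁ p₂ u) atTop (𝓝 (C₁ * l0 * √(2 * π / (D * (p₁ + p₂))))) := by
  obtain ⟨M, hM, hRb⟩ := wbound hG1 hG0 hL₁ hp₁ h
  have hpp : 0 < p₁ + p₂ := by positivity
  have hRm : Measurable (fun x => G x / (x ^ α₁ * exp (-(L₁ * x ^ p₁)))) := by fun_prop
  have key := wcore (β := α₂ + p₂ - α₁) hRm hr hM (abs_nonneg α₁) hA hD hp₁ hp₂ hRb h hrb hrl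
    (m := fun u => u ^ (p₁ / (p₁ + p₂))) (n := fun u => u ^ (p₂ / (p₁ + p₂)))
    (l := fun u => u ^ (p₁ * p₂ / (p₁ + p₂)))
    (tendsto_rpow_atTop (by positivity)) (tendsto_rpow_atTop (by positivity))
    (tendsto_rpow_atTop (by positivity))
  refine key.congr' ?_
  filter_upwards [eventually_gt_atTop 0] with u hu
  set m := u ^ (p₁ / (p₁ + p₂)) with hm
  set n := u ^ (p₂ / (p₁ + p₂)) with hn
  set l := u ^ (p₁ * p₂ / (p₁ + p₂)) with hl
  have hm0 : 0 < m := rpow_pos_of_pos hu _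
  have hn0 : 0 < n := rpow_pos_of_pos hu _
  have hl0 : 0 < l := rpow_pos_of_pos hu _
  have hmn : n * m = u := by
    rw [hm, hn, ← rpow_add hu, ← add_div, add_comm, div_self hpp.ne', rpow_one]
  have hmp : m ^ p₂ = l := by
    rw [hm, hl, ← rpow_mul hu.le]; congr 1; ring
  have hnp : n ^ p₁ = l := by
    rw [hn, hl, ← rpow_mul hu.le]; congr 1; ring
  have hk : 0 < √l := sqrt_pos.2 hl0
  rw [wcov _ (mul_pos hA hm0) hk, ← integral_div]
  congr 1; ext s
  unfold wT
  rw [← hm, ← hn, ← hl]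
  set t := s / √l with ht
  have hx : u / (A * m * exp t) = n / A * exp (-t) := by
    rw [exp_neg, ← hmn]; field_simp
  rw [hx]
  set x := n / A * exp (-t) with hxdef
  set y := A * m * exp t with hydef
  have hx0 : 0 < x := by positivity
  have hy0 : 0 < y := by positivity
  have hxp : L₁ * x ^ p₁ = l * (L₁ * A ^ (-p₁)) * exp (-(p₁ * t)) := by
    rw [hxdef, mul_rpow (by positivity) (exp_pos _).le, div_rpow hn0.le hA.le, hnp, ← exp_mul,
      rpow_neg hA.le]
    rw [show -t * p₁ = -(p₁ * t) by ring]
    ring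
  have hyp : L₂ * y ^ p₂ = l * (L₂ * A ^ p₂) * exp (p₂ * t) := by
    rw [hydef, mul_rpow (by positivity) (exp_pos _).le, mul_rpow hA.le hm0.le, hmp, ← exp_mul,
      mul_comm t]
    ring
  have hw : -(l * wE D p₁ p₂ t) = -(L₁ * x ^ p₁) + -(L₂ * y ^ p₂) + B * l := by
    rw [hxp, hyp, hB]
    have a1 : L₁ * A ^ (-p₁) = D / p₁ := by rw [hD1]; field_simp
    have a2 : L₂ * A ^ p₂ = D / p₂ := by rw [hD2]; field_simp
    rw [a1, a2]; unfold wE; field_simp; ring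
  have hxa : x ^ α₁ = (n / A) ^ α₁ * exp (-(α₁ * t)) := by
    rw [hxdef, mul_rpow (by positivity) (exp_pos _).le, ← exp_mul]
    rw [show -t * α₁ = -(α₁ * t) by ring]
  have hya : y ^ (α₂ + p₂ - 1) * y = (A * m) ^ (α₂ + p₂) * exp ((α₂ + p₂) * t) := by
    rw [rpow_sub_one hy0.ne', div_mul_cancel₀ _ hy0.ne', hydef,
      mul_rpow (by positivity) (exp_pos _).le, ← exp_mul, mul_comm t]
  have hbt : exp ((α₂ + p₂ - α₁) * t) = exp ((α₂ + p₂) * t) * exp (-(α₁ * t)) := by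
    rw [← exp_add]; congr 1; ring
  rw [hw, exp_add, exp_add, hbt]
  have e1 : exp (-(B * l)) = (exp (B * l))⁻¹ := exp_neg _
  rw [e1, hxa]
  have z1 : 0 < (n / A) ^ α₁ := by positivity
  have z2 : 0 < (A * m) ^ (α₂ + p₂) := by positivity
  have fin : y / √l * (G x * (r y * (y ^ (α₂ + p₂ - 1) * exp (-(L₂ * y ^ p₂))))) =
      (y ^ (α₂ + p₂ - 1) * y) * (G x * r y * exp (-(L₂ * y ^ p₂))) / √l := by ring
  rw [fin, hya]
  field_simp

lemma wmeas (u : ℝ) : MeasurableSet {p : ℝ × ℝ | u < p.1 * p.2} :=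
  measurableSet_lt measurable_const (by fun_prop)

lemma wprod (μ₁ : Measure ℝ) [IsProbabilityMeasure μ₁] {ρ : ℝ → ℝ} (hρ : Measurable ρ)
    (hρ0 : ∀ y, 0 < y → 0 ≤ ρ y) {u : ℝ} :
    (μ₁.prod ((volume.restrict (Set.Ioi 0)).withDensity (fun y => ENNReal.ofReal (ρ y))))
      {p : ℝ × ℝ | u < p.1 * p.2} =
    ∫⁻ y in Set.Ioi 0, ENNReal.ofReal ((μ₁ (Set.Ioi (u / y))).toReal * ρ y) := by
  have hm : Measurable fun y : ℝ => μ₁ ((fun x => (x, y)) ⁻¹' {p : ℝ × ℝ | u < p.1 * p.2}) :=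
    measurable_measure_prodMk_right (wmeas u)
  rw [Measure.prod_apply_symm (wmeas u),
    lintegral_withDensity_eq_lintegral_mul _ hρ.ennreal_ofReal hm]
  refine setLIntegral_congr_fun measurableSet_Ioi fun y hy => ?_
  have hy : 0 < y := hy
  have hs : (fun x => (x, y)) ⁻¹' {p : ℝ × ℝ | u < p.1 * p.2} = Set.Ioi (u / y) := by
    ext x; simp [div_lt_iff₀ hy]
  simp only [Pi.mul_apply, hs]
  rw [ENNReal.ofReal_mul ENNReal.toReal_nonneg, ENNReal.ofReal_toReal (measure_ne_top _ _),
    mul_comm]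

lemma wsection (μ₁ : Measure ℝ) (h0 : ∀ᵐ x ∂μ₁, 0 < x) (μ ν : Measure ℝ) [SFinite μ] [SFinite ν]
    (hle : ∀ z, 0 < z → μ (Set.Ioi z) ≤ ν (Set.Ioi z)) {u : ℝ} (hu : 0 < u) :
    (μ₁.prod μ) {p : ℝ × ℝ | u < p.1 * p.2} ≤ (μ₁.prod ν) {p : ℝ × ℝ | u < p.1 * p.2} := by
  rw [Measure.prod_apply (wmeas u), Measure.prod_apply (wmeas u)]
  refine lintegral_mono_ae ?_
  filter_upwards [h0] with x hx
  have hs : Prod.mk x ⁻¹' {p : ℝ × ℝ | u < p.1 * p.2} = Set.Ioi (u / x) := by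
    ext y; simp [div_lt_iff₀ hx, mul_comm]
  rw [hs]
  exact hle _ (by positivity)

lemma wdens {ρ : ℝ → ℝ} {z : ℝ} (hz : 0 < z) :
    ((volume.restrict (Set.Ioi 0)).withDensity (fun y => ENNReal.ofReal (ρ y))) (Set.Ioi z) =
    ∫⁻ y in Set.Ioi z, ENNReal.ofReal (ρ y) := by
  rw [withDensity_apply _ measurableSet_Ioi, Measure.restrict_restrict measurableSet_Ioi]
  congr 2
  exact Set.inter_eq_left.2 (Set.Ioi_subset_Ioi hz.le)

lemma wGmeas (μ₁ : Measure ℝ) [IsProbabilityMeasure μ₁] :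
    Measurable fun x => (μ₁ (Set.Ioi x)).toReal := by
  apply Antitone.measurable
  intro x y hxy
  exact ENNReal.toReal_mono (measure_ne_top _ _) (measure_mono (Set.Ioi_subset_Ioi hxy))

lemma wupper (μ₁ μ₂ : Measure ℝ) [IsProbabilityMeasure μ₁] [IsProbabilityMeasure μ₂]
    (h0 : ∀ᵐ x ∂μ₁, 0 < x) {ρ : ℝ → ℝ} (hρ : Measurable ρ) (hρ0 : ∀ y, 0 < y → 0 ≤ ρ y)
    (hle : ∀ z, 0 < z → μ₂ (Set.Ioi z) ≤ ∫⁻ y in Set.Ioi z, ENNReal.ofReal (ρ y))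
    {u : ℝ} (hu : 0 < u)
    (hint : IntegrableOn (fun y => (μ₁ (Set.Ioi (u / y))).toReal * ρ y) (Set.Ioi 0)) :
    ((μ₁.prod μ₂) {p : ℝ × ℝ | u < p.1 * p.2}).toReal ≤
      ∫ y in Set.Ioi 0, (μ₁ (Set.Ioi (u / y))).toReal * ρ y := by
  have hnn : 0 ≤ᵐ[volume.restrict (Set.Ioi 0)]
      (fun y => (μ₁ (Set.Ioi (u / y))).toReal * ρ y) := by
    filter_upwards [ae_restrict_mem measurableSet_Ioi] with y hy
    exact mul_nonneg ENNReal.toReal_nonneg (hρ0 y hy)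
  have h := wsection μ₁ h0 μ₂
    ((volume.restrict (Set.Ioi 0)).withDensity (fun y => ENNReal.ofReal (ρ y)))
    (fun z hz => by rw [wdens hz]; exact hle z hz) hu
  rw [wprod μ₁ hρ hρ0, ← ofReal_integral_eq_lintegral_ofReal hint hnn] at h
  exact ENNReal.toReal_le_of_le_ofReal (integral_nonneg_of_ae hnn) h

lemma wlower (μ₁ μ₂ : Measure ℝ) [IsProbabilityMeasure μ₁] [IsProbabilityMeasure μ₂]
    (h0 : ∀ᵐ x ∂μ₁, 0 < x) {ρ : ℝ → ℝ} (hρ : Measurable ρ) (hρ0 : ∀ y, 0 < y → 0 ≤ ρ y)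
    (hle : ∀ z, 0 < z → ∫⁻ y in Set.Ioi z, ENNReal.ofReal (ρ y) ≤ μ₂ (Set.Ioi z))
    {u : ℝ} (hu : 0 < u) :
    ∫ y in Set.Ioi 0, (μ₁ (Set.Ioi (u / y))).toReal * ρ y ≤
    ((μ₁.prod μ₂) {p : ℝ × ℝ | u < p.1 * p.2}).toReal := by
  have hnn : 0 ≤ᵐ[volume.restrict (Set.Ioi 0)]
      (fun y => (μ₁ (Set.Ioi (u / y))).toReal * ρ y) := by
    filter_upwards [ae_restrict_mem measurableSet_Ioi] with y hy
    exact mul_nonneg ENNReal.toReal_nonneg (hρ0 y hy)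
  have h := wsection μ₁ h0 ((volume.restrict (Set.Ioi 0)).withDensity
    (fun y => ENNReal.ofReal (ρ y))) μ₂
    (fun z hz => by rw [wdens hz]; exact hle z hz) hu
  rw [wprod μ₁ hρ hρ0] at h
  have hG := wGmeas μ₁
  have hmm : Measurable (fun y => (μ₁ (Set.Ioi (u / y))).toReal * ρ y) :=
    (hG.comp (measurable_const.div measurable_id)).mul hρ
  rw [integral_eq_lintegral_of_nonneg_ae hnn hmm.aestronglyMeasurable]
  exact ENNReal.toReal_mono (measure_ne_top _ _) h

lemma wg_tendsto {C L p α : ℝ} (hL : 0 < L) (hp : 0 < p) :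
    Tendsto (fun y : ℝ => C * y ^ α * exp (-(L * y ^ p))) atTop (𝓝 0) := by
  have h := ((tendsto_rpow_mul_exp_neg_mul_atTop_nhds_zero (α / p) L hL).comp
    (tendsto_rpow_atTop hp)).const_mul C
  rw [mul_zero] at h
  refine h.congr' ?_
  filter_upwards [eventually_gt_atTop 0] with y hy
  simp only [Function.comp]
  rw [← rpow_mul hy.le, mul_div_cancel₀ _ hp.ne', neg_mul, mul_assoc]

lemma wg_deriv {C L p α y : ℝ} (hy : 0 < y) :
    HasDerivAt (fun y : ℝ => C * y ^ α * exp (-(L * y ^ p)))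
      (-(C * (L * p - α * y ^ (-p)) * (y ^ (α + p - 1) * exp (-(L * y ^ p))))) y := by
  have h1 := (hasDerivAt_rpow_const (p := α) (Or.inl hy.ne')).const_mul C
  have h2 := ((hasDerivAt_rpow_const (p := p) (Or.inl hy.ne')).const_mul L).neg.exp
  refine (h1.mul h2).congr_deriv ?_
  have e1 : y ^ (α + p - 1) = y ^ α * y ^ p / y := by
    rw [rpow_sub_one hy.ne', rpow_add hy]
  have e2 : y ^ (α - 1) = y ^ α / y := rpow_sub_one hy.ne' _
  have e3 : y ^ (p - 1) = y ^ p / y := rpow_sub_one hy.ne' _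
  rw [e1, e2, e3, rpow_neg hy.le]
  have : 0 < y ^ p := rpow_pos_of_pos hy _
  simp only [Pi.neg_apply]
  field_simp
  ring

lemma wg_tail {C L p α K : ℝ} (hC : 0 < C) (hL : 0 < L) (hp : 0 < p) (hK : 0 < K)
    (hKr : ∀ y, K ≤ y → 0 ≤ L * p - α * y ^ (-p)) {z : ℝ} (hz : K ≤ z) :
    ∫⁻ y in Set.Ioi z, ENNReal.ofReal
      (C * (L * p - α * y ^ (-p)) * (y ^ (α + p - 1) * exp (-(L * y ^ p)))) =
    ENNReal.ofReal (C * z ^ α * exp (-(L * z ^ p))) := by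
  have hd : ∀ x ∈ Set.Ici z, HasDerivAt (fun y : ℝ => C * y ^ α * exp (-(L * y ^ p)))
      (-(C * (L * p - α * x ^ (-p)) * (x ^ (α + p - 1) * exp (-(L * x ^ p))))) x :=
    fun x hx => wg_deriv (hK.trans_le (hz.trans hx))
  have hnn : ∀ x ∈ Set.Ioi z,
      0 ≤ C * (L * p - α * x ^ (-p)) * (x ^ (α + p - 1) * exp (-(L * x ^ p))) := by
    intro x hx
    have hx' : z < x := hx
    have := hKr x (hz.trans hx'.le)
    have : 0 < x := by linarith
    positivity
  have hn : ∀ x ∈ Set.Ioi z,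
      -(C * (L * p - α * x ^ (-p)) * (x ^ (α + p - 1) * exp (-(L * x ^ p)))) ≤ 0 :=
    fun x hx => neg_nonpos.2 (hnn x hx)
  have h1 := integral_Ioi_of_hasDerivAt_of_nonpos' hd hn (wg_tendsto hL hp)
  have h2 := integrableOn_Ioi_deriv_of_nonpos' hd hn (wg_tendsto hL hp)
  have h2' : IntegrableOn (fun x => C * (L * p - α * x ^ (-p)) *
      (x ^ (α + p - 1) * exp (-(L * x ^ p)))) (Set.Ioi z) := by
    simpa using h2.neg
  rw [integral_neg] at h1
  rw [← ofReal_integral_eq_lintegral_ofReal h2'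
    (by filter_upwards [ae_restrict_mem measurableSet_Ioi] with x hx using hnn x hx)]
  congr 1
  linarith

/-- The perturbed density factor. -/
noncomputable def wr (C L p α K k N y : ℝ) : ℝ :=
  (Set.Ioi K).indicator (fun y => k * (C * (L * p - α * y ^ (-p)))) y +
    (Set.Ioc K (K + 1)).indicator (fun _ => N) y

lemma wr_meas (C L p α K k N : ℝ) : Measurable (wr C L p α K k N) := by
  unfold wr
  refine Measurable.add (Measurable.indicator (by fun_prop) measurableSet_Ioi)
    (measurable_const.indicator measurableSet_Ioc)

lemma wr_nonneg {C L p α K k N : ℝ} (hC : 0 < C) (hk : 0 ≤ k) (hN : 0 ≤ N)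
    (hKr : ∀ y, K ≤ y → 0 ≤ L * p - α * y ^ (-p)) (y : ℝ) : 0 ≤ wr C L p α K k N y := by
  unfold wr
  refine add_nonneg (Set.indicator_nonneg (fun y hy => ?_) _)
    (Set.indicator_nonneg (fun y hy => hN) _)
  have := hKr y (le_of_lt hy)
  positivity

lemma wr_bound {C L p α K k N : ℝ} (hC : 0 < C) (hL : 0 < L) (hp : 0 < p) (hk : 0 ≤ k)
    (hN : 0 ≤ N) (hK : 1 ≤ K) (y : ℝ) :
    |wr C L p α K k N y| ≤ k * (C * (L * p + |α|)) + N := by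
  unfold wr
  refine (abs_add_le _ _).trans (add_le_add ?_ ?_)
  · by_cases hy : y ∈ Set.Ioi K
    · rw [Set.indicator_of_mem hy, abs_mul, abs_mul, abs_of_nonneg hk, abs_of_pos hC]
      gcongr
      have hy' : K < y := hy
      have h1 : y ^ (-p) ≤ 1 := rpow_le_one_of_one_le_of_nonpos (by linarith) (by linarith)
      have h0 : 0 ≤ y ^ (-p) := rpow_nonneg (by linarith) _
      refine (abs_sub _ _).trans ?_
      rw [abs_of_pos (by positivity : 0 < L * p), abs_mul, abs_of_nonneg h0]
      gcongr
      exact mul_le_of_le_one_right (abs_nonneg _) h1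
    · rw [Set.indicator_of_notMem hy, abs_zero]; positivity
  · by_cases hy : y ∈ Set.Ioc K (K + 1)
    · rw [Set.indicator_of_mem hy, abs_of_nonneg hN]
    · rw [Set.indicator_of_notMem hy, abs_zero]; exact hN

lemma wr_lim {C L p α K k N : ℝ} (hp : 0 < p) :
    Tendsto (wr C L p α K k N) atTop (𝓝 (k * (C * (L * p)))) := by
  have h : Tendsto (fun y : ℝ => k * (C * (L * p - α * y ^ (-p)))) atTop
      (𝓝 (k * (C * (L * p - α * 0)))) :=
    ((((tendsto_rpow_neg_atTop hp).const_mul α).const_sub (L * p)).const_mul C).const_mul k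
  rw [mul_zero, sub_zero] at h
  refine h.congr' ?_
  filter_upwards [eventually_gt_atTop (K + 1)] with y hy
  unfold wr
  rw [Set.indicator_of_mem (show y ∈ Set.Ioi K from by simp; linarith),
    Set.indicator_of_notMem (by simp [hy]), add_zero]

lemma wr_tail_lower {C L p α K k : ℝ} (hC : 0 < C) (hL : 0 < L) (hp : 0 < p) (hK : 1 ≤ K)
    (hk : 0 < k) (hKr : ∀ y, K ≤ y → 0 ≤ L * p - α * y ^ (-p))
    (μ : Measure ℝ) [IsProbabilityMeasure μ]
    (hle : ∀ z, K ≤ z → k * (C * z ^ α * exp (-(L * z ^ p))) ≤ (μ (Set.Ioi z)).toReal) (z : ℝ) :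
    ∫⁻ y in Set.Ioi z, ENNReal.ofReal (wr C L p α K k 0 y *
      (y ^ (α + p - 1) * exp (-(L * y ^ p)))) ≤ μ (Set.Ioi z) := by
  have e : ∀ y, ENNReal.ofReal (wr C L p α K k 0 y * (y ^ (α + p - 1) * exp (-(L * y ^ p)))) =
      (Set.Ioi K).indicator (fun y => ENNReal.ofReal
        (k * C * (L * p - α * y ^ (-p)) * (y ^ (α + p - 1) * exp (-(L * y ^ p))))) y := by
    intro y
    unfold wr
    by_cases hy : y ∈ Set.Ioi K
    · simp [Set.indicator_of_mem hy, mul_assoc]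
    · simp [Set.indicator_of_notMem hy]
  simp_rw [e]
  rw [lintegral_indicator measurableSet_Ioi, Measure.restrict_restrict measurableSet_Ioi,
    Set.Ioi_inter_Ioi]
  change ∫⁻ y in Set.Ioi (max K z), _ ≤ _
  rw [wg_tail (mul_pos hk hC) hL hp (by linarith) hKr (le_max_left K z)]
  calc _ ≤ ENNReal.ofReal (μ (Set.Ioi (max K z))).toReal := by
        apply ENNReal.ofReal_le_ofReal
        have := hle _ (le_max_left K z)
        linarith
    _ = μ (Set.Ioi (max K z)) := ENNReal.ofReal_toReal (measure_ne_top _ _)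
    _ ≤ _ := measure_mono (Set.Ioi_subset_Ioi (le_max_right _ _))

lemma wr_tail_upper {C L p α K k : ℝ} (hC : 0 < C) (hL : 0 < L) (hp : 0 < p) (hK : 1 ≤ K)
    (hk : 0 < k) (hKr : ∀ y, K ≤ y → 0 ≤ L * p - α * y ^ (-p))
    (μ : Measure ℝ) [IsProbabilityMeasure μ]
    (hle : ∀ z, K ≤ z → (μ (Set.Ioi z)).toReal ≤ k * (C * z ^ α * exp (-(L * z ^ p)))) :
    ∃ N, 0 ≤ N ∧ ∀ z, μ (Set.Ioi z) ≤
    ∫⁻ y in Set.Ioi z, ENNReal.ofReal (wr C L p α K k N y *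
      (y ^ (α + p - 1) * exp (-(L * y ^ p)))) := by
  have hcont : ContinuousOn (fun y : ℝ => y ^ (α + p - 1) * exp (-(L * y ^ p)))
      (Set.Icc K (K + 1)) := by
    intro y hy
    have hy0 : y ≠ 0 := by have := hy.1; linarith
    apply ContinuousAt.continuousWithinAt
    have h1 := continuousAt_rpow_const y (α + p - 1) (Or.inl hy0)
    have h2 := continuousAt_rpow_const y p (Or.inl hy0)
    exact h1.mul (h2.const_mul L).neg.rexp
  obtain ⟨y0, hy0, hmin⟩ := isCompact_Icc.exists_isMinOn
    (Set.nonempty_Icc.2 (by linarith : K ≤ K + 1)) hcont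
  have hy0' : 0 < y0 := by have := hy0.1; linarith
  set w0 := y0 ^ (α + p - 1) * exp (-(L * y0 ^ p)) with hw0
  have hw0p : 0 < w0 := by positivity
  have hr0 : ∀ y, 0 ≤ (Set.Ioi K).indicator (fun y => k * (C * (L * p - α * y ^ (-p)))) y := by
    intro y
    refine Set.indicator_nonneg (fun y hy => ?_) _
    have := hKr y (le_of_lt hy)
    positivity
  have hi0 : ∀ y, 0 ≤ (Set.Ioc K (K + 1)).indicator (fun _ => 1 / w0) y := by
    intro y
    exact Set.indicator_nonneg (fun y hy => by positivity) _
  refine ⟨1 / w0, by positivity, fun z => ?_⟩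
  rcases le_or_gt K z with hz | hz
  · calc μ (Set.Ioi z) = ENNReal.ofReal (μ (Set.Ioi z)).toReal :=
          (ENNReal.ofReal_toReal (measure_ne_top _ _)).symm
      _ ≤ ENNReal.ofReal (k * C * z ^ α * exp (-(L * z ^ p))) := by
          apply ENNReal.ofReal_le_ofReal
          have := hle _ hz
          linarith
      _ = _ := (wg_tail (mul_pos hk hC) hL hp (by linarith) hKr hz).symm
      _ ≤ _ := by
          refine setLIntegral_mono' measurableSet_Ioi fun y hy => ?_
          apply ENNReal.ofReal_le_ofReal
          have hy' : z < y := hy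
          have hy0 : 0 < y := by linarith
          gcongr
          unfold wr
          rw [Set.indicator_of_mem (show y ∈ Set.Ioi K from lt_of_le_of_lt hz hy')]
          have := hi0 y
          linarith
  · calc μ (Set.Ioi z) ≤ 1 := prob_le_one
      _ = ∫⁻ y in Set.Ioc K (K + 1), 1 := by simp
      _ ≤ ∫⁻ y in Set.Ioc K (K + 1), ENNReal.ofReal (wr C L p α K k (1 / w0) y *
            (y ^ (α + p - 1) * exp (-(L * y ^ p)))) := by
          refine setLIntegral_mono' measurableSet_Ioc fun y hy => ?_
          rw [ENNReal.one_le_ofReal]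
          have h1 : w0 ≤ y ^ (α + p - 1) * exp (-(L * y ^ p)) :=
            hmin ⟨hy.1.le, hy.2⟩
          calc 1 = 1 / w0 * w0 := by field_simp
            _ ≤ _ := by
              have h2 : 1 / w0 ≤ wr C L p α K k (1 / w0) y := by
                unfold wr
                rw [Set.indicator_of_mem hy]
                have := hr0 y
                linarith
              have h3 : 0 ≤ 1 / w0 := by positivity
              exact mul_le_mul h2 h1 hw0p.le (h3.trans h2)
      _ ≤ _ := by
          apply lintegral_mono_set
          intro y hy
          exact hz.trans hy.1

lemma wmain (μ₁ μ₂ : Measure ℝ) [IsProbabilityMeasure μ₁] [IsProbabilityMeasure μ₂]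
    (h0 : ∀ᵐ x ∂μ₁, 0 < x) {C₁ C₂ L₁ L₂ p₁ p₂ α₁ α₂ A B D : ℝ}
    (hC₁ : 0 < C₁) (hC₂ : 0 < C₂)
    (hL₁ : 0 < L₁) (hL₂ : 0 < L₂) (hp₁ : 0 < p₁) (hp₂ : 0 < p₂) (hA : 0 < A) (hD : 0 < D)
    (hD1 : D = p₁ * L₁ * A ^ (-p₁)) (hD2 : D = p₂ * L₂ * A ^ p₂)
    (hB : B = L₁ * A ^ (-p₁) + L₂ * A ^ p₂)
    (h₁ : Tendsto (fun u => (μ₁ (Set.Ioi u)).toReal /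
        (C₁ * u ^ α₁ * Real.exp (-(L₁ * u ^ p₁)))) atTop (𝓝 1))
    (h₂ : Tendsto (fun u => (μ₂ (Set.Ioi u)).toReal /
        (C₂ * u ^ α₂ * Real.exp (-(L₂ * u ^ p₂)))) atTop (𝓝 1)) :
    Tendsto (fun u => ((μ₁.prod μ₂) {p : ℝ × ℝ | u < p.1 * p.2}).toReal /
      wT A B α₁ α₂ p₁ p₂ u) atTop
      (𝓝 (C₁ * (C₂ * (L₂ * p₂)) * √(2 * π / (D * (p₁ + p₂))))) := by
  have h : Tendsto (fun x => (μ₁ (Set.Ioi x)).toReal / (x ^ α₁ * exp (-(L₁ * x ^ p₁)))) atTop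
      (𝓝 C₁) := by
    have := h₁.const_mul C₁
    rw [mul_one] at this
    refine this.congr fun u => ?_
    rw [mul_assoc, ← div_div, mul_div_assoc', mul_div_cancel₀ _ hC₁.ne']
  have hwT : ∀ u, 0 < u → 0 < wT A B α₁ α₂ p₁ p₂ u := by
    intro u hu; unfold wT; positivity
  set S := √(2 * π / (D * (p₁ + p₂))) with hS
  have hS0 : 0 < S := by rw [hS]; positivity
  have hK1 : ∀ᶠ y : ℝ in atTop, 0 ≤ L₂ * p₂ - α₂ * y ^ (-p₂) := by
    have : Tendsto (fun y : ℝ => L₂ * p₂ - α₂ * y ^ (-p₂)) atTop (𝓝 (L₂ * p₂ - α₂ * 0)) :=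
      ((tendsto_rpow_neg_atTop hp₂).const_mul α₂).const_sub (L₂ * p₂)
    rw [mul_zero, sub_zero] at this
    filter_upwards [this.eventually_const_lt (by positivity : 0 < L₂ * p₂)] with y hy using hy.le
  have lap : ∀ K k N, 1 ≤ K → 0 < k → 0 ≤ N →
      Tendsto (fun u => (∫ y in Set.Ioi 0, (μ₁ (Set.Ioi (u / y))).toReal *
        (wr C₂ L₂ p₂ α₂ K k N y * (y ^ (α₂ + p₂ - 1) * exp (-(L₂ * y ^ p₂))))) /
        wT A B α₁ α₂ p₁ p₂ u) atTop (𝓝 (C₁ * (k * (C₂ * (L₂ * p₂))) * S)) := by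
    intro K k N hK hk hN
    exact wlaplace (G := fun x => (μ₁ (Set.Ioi x)).toReal) (wGmeas μ₁)
      (fun x => by
        have : μ₁ (Set.Ioi x) ≤ 1 := prob_le_one
        exact ENNReal.toReal_mono ENNReal.one_ne_top this)
      (fun x => ENNReal.toReal_nonneg)
      (wr_meas C₂ L₂ p₂ α₂ K k N) hL₁ hp₁ hp₂ hA hD hD1 hD2 hB h
      (fun y _ => wr_bound hC₂ hL₂ hp₂ hk.le hN hK y) (wr_lim hp₂)
  have hρm : ∀ K k N, Measurable fun y : ℝ =>
      wr C₂ L₂ p₂ α₂ K k N y * (y ^ (α₂ + p₂ - 1) * exp (-(L₂ * y ^ p₂))) := by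
    intro K k N
    have := wr_meas C₂ L₂ p₂ α₂ K k N
    fun_prop
  have cont : Tendsto (fun k : ℝ => C₁ * (k * (C₂ * (L₂ * p₂))) * S) (𝓝 1)
      (𝓝 (C₁ * (C₂ * (L₂ * p₂)) * S)) := by
    have : Tendsto (fun k : ℝ => C₁ * (k * (C₂ * (L₂ * p₂))) * S) (𝓝 1)
      (𝓝 (C₁ * (1 * (C₂ * (L₂ * p₂))) * S)) := Continuous.tendsto (by fun_prop) 1
    simpa using this
  refine tendsto_order.2 ⟨fun a ha => ?_, fun a ha => ?_⟩
  · obtain ⟨k, hka, hk0, hk1⟩ : ∃ k, a < C₁ * (k * (C₂ * (L₂ * p₂))) * S ∧ 0 < k ∧ k < 1 := by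
      have e1 := (cont.mono_left (nhdsWithin_le_nhds (s := Set.Iio 1))).eventually_const_lt ha
      have e2 : ∀ᶠ k : ℝ in 𝓝[<] 1, k ∈ Set.Ioo (0:ℝ) 1 := Ioo_mem_nhdsLT one_pos
      obtain ⟨k, h1, h2⟩ := (e1.and e2).exists
      exact ⟨k, h1, h2.1, h2.2⟩
    obtain ⟨K', hK'⟩ := eventually_atTop.1
      ((hK1.and (h₂.eventually_const_lt hk1)).and (eventually_ge_atTop 1))
    have hK : 1 ≤ K' := (hK' K' le_rfl).2
    have hle : ∀ z, K' ≤ z → k * (C₂ * z ^ α₂ * exp (-(L₂ * z ^ p₂))) ≤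
        (μ₂ (Set.Ioi z)).toReal := by
      intro z hz
      have hz0 : 0 < z := by linarith
      have := (hK' z hz).1.2
      rw [lt_div_iff₀ (by positivity)] at this
      exact this.le
    have hKr : ∀ y, K' ≤ y → 0 ≤ L₂ * p₂ - α₂ * y ^ (-p₂) := fun y hy => (hK' y hy).1.1
    filter_upwards [(lap K' k 0 hK hk0 le_rfl).eventually_const_lt hka, eventually_gt_atTop 0]
      with u hu1 hu
    refine hu1.trans_le ?_
    have := hwT u hu
    gcongr
    exact wlower μ₁ μ₂ h0 (hρm K' k 0)
      (fun y hy => mul_nonneg (wr_nonneg hC₂ hk0.le le_rfl hKr y) (by positivity))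
      (fun z _ => wr_tail_lower hC₂ hL₂ hp₂ hK hk0 hKr μ₂ hle z) hu
  · obtain ⟨k, hka, hk1⟩ : ∃ k, C₁ * (k * (C₂ * (L₂ * p₂))) * S < a ∧ 1 < k := by
      have e1 := (cont.mono_left (nhdsWithin_le_nhds (s := Set.Ioi 1))).eventually_lt_const ha
      have e2 : ∀ᶠ k : ℝ in 𝓝[>] 1, k ∈ Set.Ioi (1:ℝ) := self_mem_nhdsWithin
      obtain ⟨k, h1, h2⟩ := (e1.and e2).exists
      exact ⟨k, h1, h2⟩
    have hk0 : 0 < k := by linarith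
    obtain ⟨K', hK'⟩ := eventually_atTop.1
      ((hK1.and (h₂.eventually_lt_const hk1)).and (eventually_ge_atTop 1))
    have hK : 1 ≤ K' := (hK' K' le_rfl).2
    have hle : ∀ z, K' ≤ z → (μ₂ (Set.Ioi z)).toReal ≤
        k * (C₂ * z ^ α₂ * exp (-(L₂ * z ^ p₂))) := by
      intro z hz
      have hz0 : 0 < z := by linarith
      have := (hK' z hz).1.2
      rw [div_lt_iff₀ (by positivity)] at this
      exact this.le
    have hKr : ∀ y, K' ≤ y → 0 ≤ L₂ * p₂ - α₂ * y ^ (-p₂) := fun y hy => (hK' y hy).1.1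
    obtain ⟨N, hN, htail⟩ := wr_tail_upper hC₂ hL₂ hp₂ hK hk0 hKr μ₂ hle
    have hl := lap K' k N hK hk0 hN
    filter_upwards [hl.eventually_lt_const hka, eventually_gt_atTop 0,
      hl.eventually_const_lt (show 0 < C₁ * (k * (C₂ * (L₂ * p₂))) * S by positivity)]
      with u hu1 hu hu2
    refine lt_of_le_of_lt ?_ hu1
    have hT := hwT u hu
    gcongr
    refine wupper μ₁ μ₂ h0 (hρm K' k N)
      (fun y hy => mul_nonneg (wr_nonneg hC₂ hk0.le hN hKr y) (by positivity))
      (fun z _ => htail z) hu ?_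
    refine Integrable.of_integral_ne_zero fun h => ?_
    rw [h, zero_div] at hu2
    exact lt_irrefl _ hu2



theorem weibullian_product_polynomial_case
    {Ω : Type*} [MeasureSpace Ω] [IsProbabilityMeasure (ℙ : Measure Ω)]
    (Y₁ Y₂ : Ω → ℝ) (hY₁ : Measurable Y₁) (hY₂ : Measurable Y₂)
    (hindep : IndepFun Y₁ Y₂)
    (hY₁pos : ∀ᵐ ω ∂ℙ, 0 < Y₁ ω) (hY₂pos : ∀ᵐ ω ∂ℙ, 0 < Y₂ ω)
    (C₁ C₂ L₁ L₂ p₁ p₂ α₁ α₂ : ℝ)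
    (hC₁ : 0 < C₁) (hC₂ : 0 < C₂) (hL₁ : 0 < L₁) (hL₂ : 0 < L₂)
    (hp₁ : 0 < p₁) (hp₂ : 0 < p₂)
    (h₁ : Tendsto (fun u => (ℙ {ω | Y₁ ω > u}).toReal /
        (C₁ * u ^ α₁ * Real.exp (-(L₁ * u ^ p₁)))) atTop (𝓝 1))
    (h₂ : Tendsto (fun u => (ℙ {ω | Y₂ ω > u}).toReal /
        (C₂ * u ^ α₂ * Real.exp (-(L₂ * u ^ p₂)))) atTop (𝓝 1))
    (A B : ℝ) (hA : A = ((p₁ * L₁) / (p₂ * L₂)) ^ (1 / (p₁ + p₂)))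
    (hB : B = L₁ * A ^ (-p₁) + L₂ * A ^ p₂) :
    Tendsto (fun u => (ℙ {ω | Y₁ ω * Y₂ ω > u}).toReal /
        (Real.sqrt (2 * Real.pi * p₂ * L₂ / (p₁ + p₂)) * C₁ * C₂ *
          A ^ (p₂ / 2 + α₂ - α₁) *
          u ^ ((2 * p₂ * α₁ + 2 * p₁ * α₂ + p₁ * p₂) / (2 * (p₁ + p₂))) *
          Real.exp (-(B * u ^ (p₁ * p₂ / (p₁ + p₂)))))) atTop (𝓝 1) := by
  have hpp : 0 < p₁ + p₂ := by positivity
  have hA0 : 0 < A := by rw [hA]; positivity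
  have hApow : A ^ (p₁ + p₂) = (p₁ * L₁) / (p₂ * L₂) := by
    rw [hA, ← rpow_mul (by positivity), one_div, inv_mul_cancel₀ hpp.ne', rpow_one]
  have hDD : p₂ * L₂ * A ^ p₂ = p₁ * L₁ * A ^ (-p₁) := by
    rw [rpow_add hA0] at hApow
    rw [rpow_neg hA0.le]
    have : 0 < A ^ p₁ := by positivity
    field_simp
    field_simp at hApow
    linarith
  have : IsProbabilityMeasure (Measure.map Y₁ ℙ) := Measure.isProbabilityMeasure_map hY₁.aemeasurable
  have : IsProbabilityMeasure (Measure.map Y₂ ℙ) := Measure.isProbabilityMeasure_map hY₂.aemeasurable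
  have m1 : ∀ u, (Measure.map Y₁ ℙ) (Set.Ioi u) = ℙ {ω | Y₁ ω > u} := fun u => by
    rw [Measure.map_apply hY₁ measurableSet_Ioi]; rfl
  have m2 : ∀ u, (Measure.map Y₂ ℙ) (Set.Ioi u) = ℙ {ω | Y₂ ω > u} := fun u => by
    rw [Measure.map_apply hY₂ measurableSet_Ioi]; rfl
  have hprod : ∀ u, ((Measure.map Y₁ ℙ).prod (Measure.map Y₂ ℙ)) {p : ℝ × ℝ | u < p.1 * p.2} =
      ℙ {ω | Y₁ ω * Y₂ ω > u} := fun u => by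
    rw [← (indepFun_iff_map_prod_eq_prod_map_map hY₁.aemeasurable hY₂.aemeasurable).1 hindep,
      Measure.map_apply (hY₁.prodMk hY₂) (wmeas u)]
    rfl
  have h0 : ∀ᵐ x ∂(Measure.map Y₁ ℙ), 0 < x :=
    (ae_map_iff hY₁.aemeasurable measurableSet_Ioi).2 hY₁pos
  have key := wmain (Measure.map Y₁ ℙ) (Measure.map Y₂ ℙ) h0 (α₁ := α₁) (α₂ := α₂) hC₁ hC₂ hL₁ hL₂
    hp₁ hp₂ hA0 (D := p₂ * L₂ * A ^ p₂) (by positivity) hDD rfl hB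
    (by simpa only [m1] using h₁) (by simpa only [m2] using h₂)
  simp only [hprod] at key
  set S := √(2 * π / (p₂ * L₂ * A ^ p₂ * (p₁ + p₂))) with hS
  have hS0 : 0 < S := by rw [hS]; positivity
  have key2 := key.div_const (C₁ * (C₂ * (L₂ * p₂)) * S)
  rw [div_self (by positivity)] at key2
  refine key2.congr' ?_
  filter_upwards [eventually_gt_atTop 0] with u hu
  rw [div_div]
  congr 1
  have hs : L₂ * p₂ * S = √(2 * π * p₂ * L₂ / (p₁ + p₂)) * A ^ (-(p₂ / 2)) := by
    have e1 : A ^ (-(p₂ / 2)) = √((A ^ p₂)⁻¹) := by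
      rw [sqrt_eq_rpow, ← rpow_neg hA0.le, ← rpow_mul hA0.le]; congr 1; ring
    have e2 : L₂ * p₂ = √((L₂ * p₂) ^ 2) := (sqrt_sq (by positivity)).symm
    rw [e1, e2, hS, ← sqrt_mul (by positivity), ← sqrt_mul (by positivity)]
    congr 1
    field_simp
  have hsl : √(u ^ (p₁ * p₂ / (p₁ + p₂))) = u ^ (p₁ * p₂ / (p₁ + p₂) / 2) := by
    rw [sqrt_eq_rpow, ← rpow_mul hu.le]; congr 1; ring
  have hAe : A ^ (p₂ / 2 + α₂ - α₁) = A ^ (-(p₂ / 2)) * A ^ (α₂ + p₂) / A ^ α₁ := by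
    rw [← rpow_add hA0, ← rpow_sub hA0]; congr 1; ring
  have hue : u ^ ((2 * p₂ * α₁ + 2 * p₁ * α₂ + p₁ * p₂) / (2 * (p₁ + p₂))) =
      u ^ (p₂ / (p₁ + p₂) * α₁) * u ^ (p₁ / (p₁ + p₂) * (α₂ + p₂)) /
        u ^ (p₁ * p₂ / (p₁ + p₂) / 2) := by
    rw [← rpow_add hu, ← rpow_sub hu]; congr 1; field_simp; ring
  unfold wT
  rw [hsl, hAe, hue, div_rpow (by positivity) hA0.le, mul_rpow hA0.le (by positivity),
    ← rpow_mul hu.le, ← rpow_mul hu.le]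
  have : C₁ * (C₂ * (L₂ * p₂)) * S = C₁ * C₂ * (L₂ * p₂ * S) := by ring
  rw [this, hs]
  ring
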